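/- arXiv:2408.04107 — 3 statements merged into one kernel-verified Lean document; each statement's English description precedes it below -/
import Mathlib

section
/- Let Q and K be real s×d matrices, R an orthogonal d×d real matrix, and 0 ≤ k ≤ d, with R_k the first k columns of R and R_⊥ the remaining d−k columns. Then the Frobenius norm of the decompression error satisfies ‖Q·Kᵀ − (Q·R_k)·(K·R_k)ᵀ‖_F ≤ ‖Q·R_⊥‖_F · ‖K·R_⊥‖_F. Hence if the dropped dimensions of Q·R and K·R have small norm, directly multiplying the compressed matrices approximates Q·Kᵀ. -/
open Matrix

/-- The first `k` columns of a `d × d` matrix `R` (with `k ≤ d`). -/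
def firstCols {d : ℕ} (R : Matrix (Fin d) (Fin d) ℝ) (k : ℕ) (hk : k ≤ d) :
    Matrix (Fin d) (Fin k) ℝ :=
  R.submatrix id (fun j => ⟨j.1, lt_of_lt_of_le j.2 hk⟩)

/-- The last `d - k` columns of a `d × d` matrix `R` (with `k ≤ d`). -/
def lastCols {d : ℕ} (R : Matrix (Fin d) (Fin d) ℝ) (k : ℕ) (hk : k ≤ d) :
    Matrix (Fin d) (Fin (d - k)) ℝ :=
  R.submatrix id (fun j => ⟨k + j.1, by have := j.2; omega⟩)

/-- The Frobenius norm of a real matrix. -/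
noncomputable def frob {a b : ℕ} (M : Matrix (Fin a) (Fin b) ℝ) : ℝ :=
  Real.sqrt (∑ i, ∑ j, (M i j) ^ 2)

lemma firstCols_mul_transpose_add_lastCols_mul_transpose {d : ℕ}
    (R : Matrix (Fin d) (Fin d) ℝ) (k : ℕ) (hk : k ≤ d) :
    firstCols R k hk * (firstCols R k hk)ᵀ + lastCols R k hk * (lastCols R k hk)ᵀ = R * Rᵀ := by
  ext i j
  have hd : k + (d - k) = d := Nat.add_sub_cancel' hk
  simp only [Matrix.add_apply, Matrix.mul_apply, Matrix.transpose_apply]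
  rw [← (finCongr hd).sum_comp (fun l => R i l * R j l), Fin.sum_univ_add]
  rfl

/-- Submultiplicativity of the Frobenius norm. -/
lemma frob_mul_transpose_le {a b c : ℕ} (A : Matrix (Fin a) (Fin c) ℝ)
    (B : Matrix (Fin b) (Fin c) ℝ) : frob (A * Bᵀ) ≤ frob A * frob B := by
  unfold frob
  rw [← Real.sqrt_mul (by positivity), Finset.sum_mul_sum]
  refine Real.sqrt_le_sqrt (Finset.sum_le_sum fun i _ => Finset.sum_le_sum fun j _ => ?_)
  simp only [Matrix.mul_apply, Matrix.transpose_apply]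
  exact Finset.sum_mul_sq_le_sq_mul_sq _ _ _

/-- The Frobenius norm of the decompression error is bounded by the product of
the Frobenius norms of the dropped dimensions of `Q * R` and `K * R`. -/
theorem score_error_bound {s d : ℕ}
    (Q K : Matrix (Fin s) (Fin d) ℝ) (R : Matrix (Fin d) (Fin d) ℝ)
    (hR1 : Rᵀ * R = 1) (hR2 : R * Rᵀ = 1) (k : ℕ) (hk : k ≤ d) :
    frob (Q * Kᵀ - (Q * firstCols R k hk) * (K * firstCols R k hk)ᵀ)
      ≤ frob (Q * lastCols R k hk) * frob (K * lastCols R k hk) := by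
  have h : Q * Kᵀ - (Q * firstCols R k hk) * (K * firstCols R k hk)ᵀ
      = (Q * lastCols R k hk) * (K * lastCols R k hk)ᵀ := by
    have hsplit := firstCols_mul_transpose_add_lastCols_mul_transpose R k hk
    rw [hR2] at hsplit
    rw [sub_eq_iff_eq_add']
    calc Q * Kᵀ = Q * (1 : Matrix (Fin d) (Fin d) ℝ) * Kᵀ := by rw [Matrix.mul_one]
      _ = _ := by
        rw [← hsplit]
        simp only [Matrix.transpose_mul, Matrix.mul_add, Matrix.add_mul, Matrix.mul_assoc]
  rw [h]
  exact frob_mul_transpose_le _ _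
end

section
/- Let Q and K be real s×d matrices, let M be their vertical stack (2s×d), and let M = U·Σ·Rᵀ be an SVD of M with singular values σ_1 ≥ … ≥ σ_d ≥ 0. For 0 ≤ k ≤ d, with R_k the first k columns of R, the compressed attention scores satisfy ‖Q·Kᵀ − (Q·R_k)·(K·R_k)ᵀ‖_F ≤ (1/2)·Σ_{j=k+1}^{d} σ_j². Thus computing the common rotation by an SVD of the QK concatenation bounds the attention-score error by the tail of the shared singular values. -/
open Matrix

theorem sum_firstCols_mul {a b d : ℕ} (Q : Matrix (Fin a) (Fin d) ℝ) (K : Matrix (Fin b) (Fin d) ℝ)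
    (R : Matrix (Fin d) (Fin d) ℝ) (k : ℕ) (hk : k ≤ d) (i : Fin a) (l : Fin b) :
    ((Q * firstCols R k hk) * (K * firstCols R k hk)ᵀ) i l =
      ∑ j ∈ Finset.univ.filter (fun j : Fin d => ¬ k ≤ (j : ℕ)), (Q * R) i j * (K * R) l j := by
  rw [mul_apply]
  refine Finset.sum_bij (fun j _ => ⟨j.1, lt_of_lt_of_le j.2 hk⟩) ?_ ?_ ?_ ?_
  · intro j _
    simp
  · intro j₁ _ j₂ _ h
    exact Fin.ext (by simpa using h)
  · intro j hj
    exact ⟨⟨j.1, by simpa using hj⟩, Finset.mem_univ _, rfl⟩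
  · intro j _
    rfl

/-- Truncating an orthogonal change of basis leaves exactly the contribution of the dropped
columns. -/
theorem mul_transpose_sub_firstCols_apply {a b d : ℕ} (Q : Matrix (Fin a) (Fin d) ℝ)
    (K : Matrix (Fin b) (Fin d) ℝ) (R : Matrix (Fin d) (Fin d) ℝ) (hR : R * Rᵀ = 1)
    (k : ℕ) (hk : k ≤ d) (i : Fin a) (l : Fin b) :
    (Q * Kᵀ - (Q * firstCols R k hk) * (K * firstCols R k hk)ᵀ) i l =
      ∑ j ∈ Finset.univ.filter (fun j : Fin d => k ≤ (j : ℕ)), (Q * R) i j * (K * R) l j := by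
  have h : Q * Kᵀ = (Q * R) * (K * R)ᵀ := by
    rw [transpose_mul, Matrix.mul_assoc, ← Matrix.mul_assoc R, hR, Matrix.one_mul]
  rw [Matrix.sub_apply, sum_firstCols_mul, h, mul_apply, sub_eq_iff_eq_add]
  exact (Finset.sum_filter_add_sum_filter_not _ _ _).symm

theorem sum_sq_mul_of_orthogonal {m n : ℕ} (U : Matrix (Fin m) (Fin m) ℝ) (hU : Uᵀ * U = 1)
    (S : Matrix (Fin m) (Fin n) ℝ) (j : Fin n) : ∑ i, (U * S) i j ^ 2 = ∑ i, S i j ^ 2 := by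
  have h : (U * S)ᵀ * (U * S) = Sᵀ * S := by
    rw [transpose_mul, Matrix.mul_assoc, ← Matrix.mul_assoc Uᵀ, hU, Matrix.one_mul]
  simpa only [mul_apply, transpose_apply, ← sq] using congrFun (congrFun h j) j

theorem sum_sq_col_of_diagonal {m n : ℕ} (S : Matrix (Fin m) (Fin n) ℝ)
    (hdiag : ∀ (i : Fin m) (j : Fin n), (i : ℕ) ≠ (j : ℕ) → S i j = 0) (j : Fin n) :
    ∑ i, S i j ^ 2 = (if h : (j : ℕ) < m then S ⟨j.1, h⟩ j else 0) ^ 2 := by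
  split_ifs with h
  · refine Finset.sum_eq_single (⟨j.1, h⟩ : Fin m) (fun i _ hi => ?_) (by simp)
    rw [hdiag i j (fun hij => hi (Fin.ext hij))]
    simp
  · rw [zero_pow two_ne_zero]
    refine Finset.sum_eq_zero fun i _ => ?_
    rw [hdiag i j (by omega)]
    simp

theorem sum_fin_two_mul {s : ℕ} (f : Fin (2 * s) → ℝ) :
    ∑ i, f i = ∑ i : Fin s, f ⟨i.1, by omega⟩ + ∑ i : Fin s, f ⟨s + i.1, by omega⟩ := by
  rw [← Equiv.sum_comp (finCongr (two_mul s).symm) f, Fin.sum_univ_add]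
  rfl

/-- The Frobenius norm of a product `A * Bᵀ` restricted to a set `T` of columns is at most half the
sum of the squared Frobenius norms of the restrictions. -/
theorem sqrt_sum_sq_sum_mul_le {α β ι : Type*} [Fintype α] [Fintype β] (T : Finset ι)
    (A : α → ι → ℝ) (B : β → ι → ℝ) :
    Real.sqrt (∑ i, ∑ l, (∑ j ∈ T, A i j * B l j) ^ 2) ≤
      (1 / 2) * ∑ j ∈ T, (∑ i, A i j ^ 2 + ∑ l, B l j ^ 2) := by
  have hsum : ∑ j ∈ T, (∑ i, A i j ^ 2 + ∑ l, B l j ^ 2) =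
      ∑ i, ∑ j ∈ T, A i j ^ 2 + ∑ l, ∑ j ∈ T, B l j ^ 2 := by
    rw [Finset.sum_add_distrib, Finset.sum_comm, Finset.sum_comm (s := T)]
  refine Real.sqrt_le_iff.2 ⟨by positivity, ?_⟩
  calc ∑ i, ∑ l, (∑ j ∈ T, A i j * B l j) ^ 2
      ≤ ∑ i, ∑ l, (∑ j ∈ T, A i j ^ 2) * ∑ j ∈ T, B l j ^ 2 := by
        gcongr
        exact Finset.sum_mul_sq_le_sq_mul_sq _ _ _
    _ = (∑ i, ∑ j ∈ T, A i j ^ 2) * ∑ l, ∑ j ∈ T, B l j ^ 2 := by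
        rw [Finset.sum_mul_sum]
    _ ≤ _ := by
        rw [hsum]
        nlinarith [sq_nonneg (∑ i, ∑ j ∈ T, A i j ^ 2 - ∑ l, ∑ j ∈ T, B l j ^ 2)]

/-- If `M` is the vertical stack of `Q` on top of `K`, with SVD
`M = U * Σ * Rᵀ` and singular values `σ` in descending order, then the error in
the compressed attention scores is bounded by half the tail sum of squared
singular values of the concatenation. -/
theorem score_error_bounded_by_tail {s d : ℕ}
    (Q K : Matrix (Fin s) (Fin d) ℝ)
    (M : Matrix (Fin (2 * s)) (Fin d) ℝ)
    (hMQ : ∀ (i : Fin s) (j : Fin d), M ⟨i.1, by have := i.2; omega⟩ j = Q i j)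
    (hMK : ∀ (i : Fin s) (j : Fin d), M ⟨s + i.1, by have := i.2; omega⟩ j = K i j)
    (U : Matrix (Fin (2 * s)) (Fin (2 * s)) ℝ)
    (S : Matrix (Fin (2 * s)) (Fin d) ℝ) (R : Matrix (Fin d) (Fin d) ℝ)
    (hU1 : Uᵀ * U = 1) (hU2 : U * Uᵀ = 1)
    (hR1 : Rᵀ * R = 1) (hR2 : R * Rᵀ = 1)
    (hdiag : ∀ (i : Fin (2 * s)) (j : Fin d), (i : ℕ) ≠ (j : ℕ) → S i j = 0)
    (σ : Fin d → ℝ)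
    (hσ : ∀ j : Fin d, σ j = if h : (j : ℕ) < 2 * s then S ⟨j.1, h⟩ j else 0)
    (hnonneg : ∀ j : Fin d, 0 ≤ σ j)
    (hdesc : ∀ j₁ j₂ : Fin d, j₁ ≤ j₂ → σ j₂ ≤ σ j₁)
    (hM : M = U * S * Rᵀ) (k : ℕ) (hk : k ≤ d) :
    frob (Q * Kᵀ - (Q * firstCols R k hk) * (K * firstCols R k hk)ᵀ)
      ≤ (1 / 2) * ∑ j ∈ Finset.univ.filter (fun j : Fin d => k ≤ (j : ℕ)), σ j ^ 2 := by
  have hcol : ∀ j, ∑ i, (Q * R) i j ^ 2 + ∑ i, (K * R) i j ^ 2 = σ j ^ 2 := by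
    intro j
    have hMR : M * R = U * S := by rw [hM, Matrix.mul_assoc, hR1, Matrix.mul_one]
    rw [hσ, ← sum_sq_col_of_diagonal S hdiag, ← sum_sq_mul_of_orthogonal U hU1, ← hMR,
      sum_fin_two_mul]
    simp only [mul_apply, hMQ, hMK]
  simp only [frob, mul_transpose_sub_firstCols_apply Q K R hR2, ← hcol]
  exact sqrt_sum_sq_sum_mul_le _ (Q * R) (K * R)
end

section
/- (Eckart–Young, Frobenius norm) Let A be a real m×d matrix with SVD A = U·Σ·Rᵀ and singular values σ_1 ≥ σ_2 ≥ … ≥ 0, and for 0 ≤ k let A_k = A·R_k·R_kᵀ be the rank-≤k truncated-SVD approximation (R_k the first k columns of R). Then for every real m×d matrix B with rank(B) ≤ k, ‖A − A_k‖_F ≤ ‖A − B‖_F; i.e., SVD truncation is an optimal rank-k compression in Frobenius norm. -/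
open Matrix

/-- The square of the Frobenius norm is the trace of the Gram matrix. -/
lemma frob_eq_sqrt_trace {a b : ℕ} (M : Matrix (Fin a) (Fin b) ℝ) :
    frob M = Real.sqrt (Mᵀ * M).trace := by
  rw [frob, Finset.sum_comm]
  simp [Matrix.trace, Matrix.mul_apply, pow_two]

lemma trace_transpose_mul_self_nonneg {a b : ℕ} (M : Matrix (Fin a) (Fin b) ℝ) :
    0 ≤ (Mᵀ * M).trace := by
  simp only [Matrix.trace, Matrix.diag_apply, Matrix.mul_apply, Matrix.transpose_apply]
  exact Finset.sum_nonneg fun _ _ => Finset.sum_nonneg fun _ _ => mul_self_nonneg _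

/-- Pythagoras for right multiplication by an orthogonal projection. -/
lemma trace_gram_sub_mul_projection {a b : ℕ} (M : Matrix (Fin a) (Fin b) ℝ)
    {P : Matrix (Fin b) (Fin b) ℝ} (hsymm : Pᵀ = P) (hidem : P * P = P) :
    ((M - M * P)ᵀ * (M - M * P)).trace = (Mᵀ * M).trace - (Mᵀ * M * P).trace := by
  have h1 : (P * (Mᵀ * M)).trace = (Mᵀ * M * P).trace := Matrix.trace_mul_comm _ _
  have h2 : (P * (Mᵀ * M * P)).trace = (Mᵀ * M * P).trace := by
    rw [Matrix.trace_mul_comm, Matrix.mul_assoc, hidem]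
  have h3 : (M - M * P)ᵀ * (M - M * P) =
      Mᵀ * M - Mᵀ * M * P - P * (Mᵀ * M) + P * (Mᵀ * M * P) := by
    rw [Matrix.transpose_sub, Matrix.transpose_mul, hsymm]
    simp only [Matrix.sub_mul, Matrix.mul_sub, Matrix.mul_assoc]
    abel
  rw [h3, Matrix.trace_add, Matrix.trace_sub, Matrix.trace_sub, h1, h2]
  ring

lemma trace_gram_sub_mul_projection_le {a b : ℕ} (M : Matrix (Fin a) (Fin b) ℝ)
    {P : Matrix (Fin b) (Fin b) ℝ} (hsymm : Pᵀ = P) (hidem : P * P = P) :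
    ((M - M * P)ᵀ * (M - M * P)).trace ≤ (Mᵀ * M).trace := by
  have h : ((M * P)ᵀ * (M * P)).trace = (Mᵀ * M * P).trace := by
    rw [Matrix.transpose_mul, hsymm, Matrix.mul_assoc, Matrix.trace_mul_comm,
      Matrix.mul_assoc, Matrix.mul_assoc, hidem, Matrix.mul_assoc]
  have := trace_transpose_mul_self_nonneg (M * P)
  rw [trace_gram_sub_mul_projection M hsymm hidem]
  linarith

/-- The diagonal entries of an orthogonal projection lie in `[0, 1]`. -/
lemma projection_diag_mem_Icc {b : ℕ} {P : Matrix (Fin b) (Fin b) ℝ} (hsymm : Pᵀ = P)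
    (hidem : P * P = P) (j : Fin b) : P j j ∈ Set.Icc (0 : ℝ) 1 := by
  have h : P j j = ∑ i, P i j ^ 2 := by
    conv_lhs => rw [← hidem, Matrix.mul_apply]
    refine Finset.sum_congr rfl fun i _ => ?_
    rw [pow_two, ← Matrix.transpose_apply P j i, hsymm]
  have h0 : 0 ≤ P j j := h ▸ Finset.sum_nonneg fun i _ => sq_nonneg _
  have h1 : P j j ^ 2 ≤ P j j := by
    conv_rhs => rw [h]
    exact Finset.single_le_sum (f := fun i => P i j ^ 2) (fun i _ => sq_nonneg _)
      (Finset.mem_univ j)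
  exact ⟨h0, by nlinarith⟩

/-- The orthogonal projection onto the row space of a matrix. -/
lemma exists_row_space_projection {a b : ℕ} (C : Matrix (Fin a) (Fin b) ℝ) :
    ∃ P : Matrix (Fin b) (Fin b) ℝ, Pᵀ = P ∧ P * P = P ∧ C * P = C ∧ P.trace = C.rank := by
  set T := Matrix.toEuclideanLin C with hT
  set K := (LinearMap.ker T)ᗮ with hK
  let p : EuclideanSpace ℝ (Fin b) →ₗ[ℝ] EuclideanSpace ℝ (Fin b) :=
    K.starProjection.toLinearMap
  obtain ⟨P, hP⟩ := Matrix.toEuclideanLin.surjective p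
  have hidem : p ∘ₗ p = p := by
    ext1 x
    exact K.starProjection_eq_self_iff.2 (K.starProjection_apply_mem x)
  have hTp : T ∘ₗ p = T := by
    ext1 x
    have hx : x - K.starProjection x ∈ LinearMap.ker T := by
      have hKK : Kᗮ = LinearMap.ker T := Submodule.orthogonal_orthogonal _
      exact hKK.le (K.sub_starProjection_mem_orthogonal x)
    rw [LinearMap.mem_ker, map_sub, sub_eq_zero] at hx
    exact hx.symm
  refine ⟨P, ?_, ?_, ?_, ?_⟩
  · have h : LinearMap.IsSymmetric (Matrix.toEuclideanLin P) := by
      rw [hP]; exact K.starProjection_isSymmetric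
    rw [Matrix.isSymmetric_toEuclideanLin_iff] at h
    simpa [Matrix.IsHermitian] using h
  · apply Matrix.toEuclideanLin.injective
    rw [Matrix.toLpLin_mul_same, hP, hidem]
  · apply Matrix.toEuclideanLin.injective
    rw [Matrix.toLpLin_mul_same, hP, hTp]
  · have hproj : LinearMap.IsProj K p :=
      ⟨fun x => K.starProjection_apply_mem x, fun x hx => K.starProjection_eq_self_iff.2 hx⟩
    have htr : P.trace = LinearMap.trace ℝ _ p := by
      rw [← hP, Matrix.toEuclideanLin_eq_toLin_orthonormal, Matrix.trace_toLin_eq]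
    have hr : C.rank = Module.finrank ℝ (LinearMap.range T) := by
      rw [hT, Matrix.toEuclideanLin_eq_toLin_orthonormal]
      exact Matrix.rank_eq_finrank_range_toLin C _ _
    have h1 := LinearMap.finrank_range_add_finrank_ker T
    have h2 := Submodule.finrank_add_finrank_orthogonal (LinearMap.ker T)
    rw [← hK] at h2
    rw [htr, hproj.trace, hr]
    congr 1
    omega

/-- An antitone weight is summed best against its first `k` indices. -/
lemma sum_mul_le_sum_initial {d k : ℕ} (hk : k ≤ d) {s w : Fin d → ℝ} (hs : Antitone s)
    (hs0 : ∀ j, 0 ≤ s j) (hw : ∀ j, w j ∈ Set.Icc (0 : ℝ) 1) (hsum : ∑ j, w j ≤ k) :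
    ∑ j, s j * w j ≤ ∑ j : Fin d, s j * if (j : ℕ) < k then 1 else 0 := by
  rcases hk.eq_or_lt with rfl | hlt
  · refine Finset.sum_le_sum fun j _ => ?_
    simpa using mul_le_of_le_one_right (hs0 j) (hw j).2
  · set c := s ⟨k, hlt⟩
    have hcount : ∑ j : Fin d, (if (j : ℕ) < k then (1 : ℝ) else 0) = k := by
      rw [Fin.sum_univ_eq_sum_range (fun j => if j < k then (1 : ℝ) else 0) d,
        ← Finset.sum_filter, Finset.sum_const, nsmul_one]
      congr 1
      rw [show (Finset.range d).filter (· < k) = Finset.range k by ext; simp; omega,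
        Finset.card_range]
    have hterm : ∑ j : Fin d, (s j - c) * (w j - if (j : ℕ) < k then 1 else 0) ≤ 0 := by
      refine Finset.sum_nonpos fun j _ => ?_
      split_ifs with hj
      · exact mul_nonpos_of_nonneg_of_nonpos (sub_nonneg.2 (hs (Fin.le_def.2 hj.le)))
          (sub_nonpos.2 (hw j).2)
      · rw [sub_zero]
        exact mul_nonpos_of_nonpos_of_nonneg
          (sub_nonpos.2 (hs (Fin.le_def.2 (not_lt.1 hj)))) (hw j).1
    have hexp : ∑ j : Fin d, (s j - c) * (w j - if (j : ℕ) < k then 1 else 0) =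
        ∑ j, s j * w j - ∑ j : Fin d, (s j * if (j : ℕ) < k then 1 else 0) -
          c * (∑ j, w j - ∑ j : Fin d, if (j : ℕ) < k then (1 : ℝ) else 0) := by
      simp only [mul_sub, Finset.mul_sum, ← Finset.sum_sub_distrib]
      exact Finset.sum_congr rfl fun j _ => by ring
    rw [hcount] at hexp
    have := mul_nonneg (hs0 ⟨k, hlt⟩) (sub_nonneg.2 hsum)
    linarith

lemma firstCols_mul_transpose {d : ℕ} (R : Matrix (Fin d) (Fin d) ℝ) (k : ℕ) (hk : k ≤ d) :
    firstCols R k hk * (firstCols R k hk)ᵀ =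
      R * Matrix.diagonal (fun j : Fin d => if (j : ℕ) < k then (1 : ℝ) else 0) * Rᵀ := by
  ext i l
  obtain ⟨e, rfl⟩ := Nat.exists_eq_add_of_le hk
  rw [Matrix.mul_apply, Matrix.mul_apply, Fin.sum_univ_add]
  simp [firstCols, Matrix.mul_diagonal, Fin.castAdd, Fin.castLE]

section RectangularDiagonal

variable {m d : ℕ} {S : Matrix (Fin m) (Fin d) ℝ}

lemma gram_eq_diagonal (hdiag : ∀ (i : Fin m) (j : Fin d), (i : ℕ) ≠ (j : ℕ) → S i j = 0) :
    Sᵀ * S = Matrix.diagonal fun j => ∑ i, S i j ^ 2 := by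
  ext j l
  rw [Matrix.mul_apply, Matrix.diagonal_apply]
  split_ifs with h
  · subst h
    simp [pow_two]
  · refine Finset.sum_eq_zero fun i _ => ?_
    by_cases hi : (i : ℕ) = j
    · rw [hdiag i l fun h' => h (Fin.ext (hi.symm.trans h')), mul_zero]
    · rw [Matrix.transpose_apply, hdiag i j hi, zero_mul]

lemma antitone_sum_sq_col
    (hdiag : ∀ (i : Fin m) (j : Fin d), (i : ℕ) ≠ (j : ℕ) → S i j = 0)
    (hnonneg : ∀ (i : Fin m) (j : Fin d), (i : ℕ) = (j : ℕ) → 0 ≤ S i j)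
    (hdesc : ∀ (i₁ i₂ : Fin m) (j₁ j₂ : Fin d), (i₁ : ℕ) = (j₁ : ℕ) →
      (i₂ : ℕ) = (j₂ : ℕ) → (i₁ : ℕ) ≤ (i₂ : ℕ) → S i₂ j₂ ≤ S i₁ j₁) :
    Antitone fun j => ∑ i, S i j ^ 2 := by
  intro j l hjl
  have hcol (j : Fin d) (hj : (j : ℕ) < m) : ∑ i, S i j ^ 2 = S ⟨j, hj⟩ j ^ 2 := by
    refine Finset.sum_eq_single _ (fun i _ hi => ?_) fun h => absurd (Finset.mem_univ _) h
    rw [hdiag i j fun h => hi (Fin.ext h), zero_pow two_ne_zero]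
  by_cases hl : (l : ℕ) < m
  · have hj : (j : ℕ) < m := lt_of_le_of_lt (Fin.le_def.1 hjl) hl
    simp only [hcol l hl, hcol j hj]
    exact pow_le_pow_left₀ (hnonneg _ _ rfl) (hdesc _ _ _ _ rfl rfl (Fin.le_def.1 hjl)) 2
  · refine le_of_eq_of_le (Finset.sum_eq_zero fun i _ => ?_)
      (Finset.sum_nonneg fun i _ => sq_nonneg _)
    rw [hdiag i l (by omega), zero_pow two_ne_zero]

end RectangularDiagonal

/-- Eckart–Young (Frobenius norm): the rank-`≤ k` truncated-SVD approximation
`A_k = A * R_k * R_kᵀ` is an optimal rank-`k` approximation of `A` in the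
Frobenius norm. -/
theorem eckart_young_frobenius {m d : ℕ}
    (A : Matrix (Fin m) (Fin d) ℝ) (U : Matrix (Fin m) (Fin m) ℝ)
    (S : Matrix (Fin m) (Fin d) ℝ) (R : Matrix (Fin d) (Fin d) ℝ)
    (hU1 : Uᵀ * U = 1) (hU2 : U * Uᵀ = 1)
    (hR1 : Rᵀ * R = 1) (hR2 : R * Rᵀ = 1)
    (hdiag : ∀ (i : Fin m) (j : Fin d), (i : ℕ) ≠ (j : ℕ) → S i j = 0)
    (hnonneg : ∀ (i : Fin m) (j : Fin d), (i : ℕ) = (j : ℕ) → 0 ≤ S i j)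
    (hdesc : ∀ (i₁ i₂ : Fin m) (j₁ j₂ : Fin d), (i₁ : ℕ) = (j₁ : ℕ) →
      (i₂ : ℕ) = (j₂ : ℕ) → (i₁ : ℕ) ≤ (i₂ : ℕ) → S i₂ j₂ ≤ S i₁ j₁)
    (hA : A = U * S * Rᵀ) (k : ℕ) (hk : k ≤ d)
    (B : Matrix (Fin m) (Fin d) ℝ) (hB : B.rank ≤ k) :
    frob (A - A * firstCols R k hk * (firstCols R k hk)ᵀ) ≤ frob (A - B) := by
  set E : Matrix (Fin d) (Fin d) ℝ :=
    Matrix.diagonal fun j : Fin d => if (j : ℕ) < k then (1 : ℝ) else 0 with hE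
  have hconj {X : Matrix (Fin d) (Fin d) ℝ} (hX : Xᵀ = X) (hXX : X * X = X) :
      (R * X * Rᵀ)ᵀ = R * X * Rᵀ ∧ R * X * Rᵀ * (R * X * Rᵀ) = R * X * Rᵀ := by
    refine ⟨by simp [hX, Matrix.mul_assoc], ?_⟩
    calc R * X * Rᵀ * (R * X * Rᵀ) = R * X * (Rᵀ * R) * X * Rᵀ := by noncomm_ring
      _ = R * X * Rᵀ := by rw [hR1, Matrix.mul_one, Matrix.mul_assoc R, hXX]
  have hgram (X : Matrix (Fin d) (Fin d) ℝ) :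
      (Aᵀ * A * (R * X * Rᵀ)).trace = ∑ j, (∑ i, S i j ^ 2) * X j j := by
    have h : Aᵀ * A = R * (Sᵀ * S) * Rᵀ := by
      rw [hA]
      simp only [Matrix.transpose_mul, Matrix.transpose_transpose, Matrix.mul_assoc]
      rw [← Matrix.mul_assoc Uᵀ U, hU1, Matrix.one_mul]
    have h' : R * (Sᵀ * S) * Rᵀ * (R * X * Rᵀ) = R * (Sᵀ * S * X * Rᵀ) := by
      simp only [Matrix.mul_assoc]
      rw [← Matrix.mul_assoc Rᵀ R, hR1, Matrix.one_mul]
    rw [h, h', Matrix.trace_mul_comm, Matrix.mul_assoc, hR1, Matrix.mul_one,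
      gram_eq_diagonal hdiag]
    simp [Matrix.trace, Matrix.diagonal_mul]
  obtain ⟨P, hPs, hPP, hBP, hPtr⟩ := exists_row_space_projection (B * R)
  have hP := hconj hPs hPP
  have hEs : Eᵀ = E := Matrix.diagonal_transpose _
  have hEE : E * E = E := by simp [hE, Matrix.diagonal_mul_diagonal]
  have hER := hconj hEs hEE
  have hBfix : B * (R * P * Rᵀ) = B := by
    rw [← Matrix.mul_assoc, ← Matrix.mul_assoc, hBP, Matrix.mul_assoc, hR2, Matrix.mul_one]
  have hresid : A - B - (A - B) * (R * P * Rᵀ) = A - A * (R * P * Rᵀ) := by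
    rw [Matrix.sub_mul, hBfix]
    abel
  have hsum : ∑ j, P j j ≤ (k : ℝ) :=
    le_of_eq_of_le hPtr (Nat.cast_le.2 ((Matrix.rank_mul_le_left B R).trans hB))
  have hweights := sum_mul_le_sum_initial hk (antitone_sum_sq_col hdiag hnonneg hdesc)
    (fun j => Finset.sum_nonneg fun i _ => sq_nonneg (S i j))
    (projection_diag_mem_Icc hPs hPP) hsum
  have hlower := trace_gram_sub_mul_projection_le (A - B) hP.1 hP.2
  rw [hresid, trace_gram_sub_mul_projection A hP.1 hP.2, hgram] at hlower
  rw [frob_eq_sqrt_trace, frob_eq_sqrt_trace, Matrix.mul_assoc, firstCols_mul_transpose]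
  apply Real.sqrt_le_sqrt
  rw [trace_gram_sub_mul_projection A hER.1 hER.2, hgram]
  simp only [hE, Matrix.diagonal_apply_eq]
  linarith
end
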